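/- Let c > 0, η₁ ∈ [−3,−1], η₄ ∈ [1,3] with η₄ − η₁ ≤ 4. Then L(η₁) − (3/4)(S(η₁) + S(−2−η₁)) ≤ L(η₄) + (3/4) S(2−η₄) − (5/4) S(η₄). -/

import Mathlib

noncomputable section

/-- ĝ(v) = √π e^{−π² v²}, the Fourier transform of the Gaussian e^{−x²}. -/
def gFT (v : ℝ) : ℝ := Real.sqrt Real.pi * Real.exp (-Real.pi ^ 2 * v ^ 2)

/-- S(η) = (4/π) Σ_{l=0}^∞ (−1)^l ĝ(c(2l+1+(−1)^{l+1} η)) / (2l+1). -/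
def S (c η : ℝ) : ℝ :=
  (4 / Real.pi) * ∑' l : ℕ,
    (-1 : ℝ) ^ l * gFT (c * (2 * (l : ℝ) + 1 + (-1 : ℝ) ^ (l + 1) * η)) / (2 * (l : ℝ) + 1)

/-- L(η) = (2/π) Σ_{l=0}^∞ ĝ(c(2l+1+(−1)^{l+1} η)). -/
def L (c η : ℝ) : ℝ :=
  (2 / Real.pi) * ∑' l : ℕ, gFT (c * (2 * (l : ℝ) + 1 + (-1 : ℝ) ^ (l + 1) * η))


def EE (c x : ℝ) : ℝ := gFT (c * x)

lemma EE_neg (c x : ℝ) : EE c (-x) = EE c x := by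
  unfold EE gFT; congr 2; ring

lemma EE_nonneg (c x : ℝ) : 0 ≤ EE c x := by
  unfold EE gFT; positivity

lemma EE_anti (c x y : ℝ) (hx : 0 ≤ x) (h : x ≤ y) : EE c y ≤ EE c x := by
  unfold EE gFT
  apply mul_le_mul_of_nonneg_left _ (Real.sqrt_nonneg _)
  apply Real.exp_le_exp.mpr
  have : (c * x) ^ 2 ≤ (c * y) ^ 2 := by
    rw [mul_pow, mul_pow]; gcongr
  have := mul_le_mul_of_nonneg_left this (sq_nonneg Real.pi)
  linarith

/-- the shifted samples -/
def ff (c η : ℝ) (w : ℤ) : ℝ := EE c (η - 4 * w - 1)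

lemma summable_ff (c : ℝ) (hc : 0 < c) (η : ℝ) : Summable (ff c η) := by
  have h := (HurwitzKernelBounds.summable_f_int 0 ((1 - η) / 4)
    (t := 16 * Real.pi * c ^ 2) (by positivity)).mul_left (Real.sqrt Real.pi)
  refine h.congr (fun w => ?_)
  unfold HurwitzKernelBounds.f_int ff EE gFT
  rw [pow_zero, one_mul]; congr 2; ring

lemma ne1 (w : ℤ) : (4 * (w : ℝ) + 1) ≠ 0 := by
  have : (4 * w + 1 : ℤ) ≠ 0 := by omega
  exact_mod_cast this

lemma ne3 (w : ℤ) : (4 * (w : ℝ) + 3) ≠ 0 := by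
  have : (4 * w + 3 : ℤ) ≠ 0 := by omega
  exact_mod_cast this

lemma abs1 (w : ℤ) : 1 ≤ |4 * (w : ℝ) + 1| := by
  have : (1 : ℤ) ≤ |4 * w + 1| := Int.one_le_abs (by omega)
  exact_mod_cast this

lemma summable_ffd (c : ℝ) (hc : 0 < c) (η : ℝ) :
    Summable (fun w : ℤ => ff c η w / (4 * (w : ℝ) + 1)) := by
  refine Summable.of_norm_bounded (summable_ff c hc η) (fun w => ?_)
  rw [norm_div, Real.norm_eq_abs, Real.norm_eq_abs, abs_of_nonneg (show 0 ≤ ff c η w from EE_nonneg _ _)]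
  exact div_le_self (EE_nonneg _ _) (abs1 w)

lemma L_eq (c η : ℝ) : L c η = (2 / Real.pi) * ∑' w : ℤ, ff c η w := by
  unfold L
  rw [← Equiv.intEquivNat.tsum_eq]
  congr 1
  apply tsum_congr
  rintro (p | p)
  · have : Equiv.intEquivNat (Int.ofNat p) = 2 * p := rfl
    rw [this, ← EE, ff, ← EE_neg]
    congr 1
    push_cast
    rw [pow_succ, pow_mul]; norm_num; ring
  · have : Equiv.intEquivNat (Int.negSucc p) = 2 * p + 1 := rfl
    rw [this, ← EE, ff]
    congr 1
    rw [pow_succ, pow_succ, pow_mul]; push_cast; norm_num; ring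

lemma S_eq (c η : ℝ) :
    S c η = (4 / Real.pi) * ∑' w : ℤ, ff c η w / (4 * (w : ℝ) + 1) := by
  unfold S
  rw [← Equiv.intEquivNat.tsum_eq]
  congr 1
  apply tsum_congr
  rintro (p | p)
  · have : Equiv.intEquivNat (Int.ofNat p) = 2 * p := rfl
    rw [this, ← EE, ff, ← EE_neg]
    have e : -(2 * ((2 * p : ℕ) : ℝ) + 1 + (-1) ^ (2 * p + 1) * η)
        = η - 4 * ((Int.ofNat p : ℤ) : ℝ) - 1 := by
      push_cast
      rw [pow_succ, pow_mul]; norm_num; ring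
    rw [e, pow_mul]; push_cast; norm_num; ring
  · have : Equiv.intEquivNat (Int.negSucc p) = 2 * p + 1 := rfl
    rw [this, ← EE, ff]
    have e : (2 * ((2 * p + 1 : ℕ) : ℝ) + 1 + (-1) ^ (2 * p + 1 + 1) * η)
        = η - 4 * ((Int.negSucc p : ℤ) : ℝ) - 1 := by
      rw [pow_succ, pow_succ, pow_mul]; push_cast; norm_num; ring
    rw [e, pow_succ, pow_mul]
    have h2 : 4 * ((Int.negSucc p : ℤ) : ℝ) + 1 = -(2 * ((2 * p + 1 : ℕ) : ℝ) + 1) := by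
      push_cast; ring
    rw [h2, div_neg]; norm_num
    ring

lemma S_refl1 (c : ℝ) (hc : 0 < c) (η : ℝ) :
    HasSum (fun w : ℤ => ff c η w / (-4 * (w : ℝ) - 3)) (S c (-2 - η) / (4 / Real.pi)) := by
  have h := (summable_ffd c hc (-2 - η)).hasSum
  rw [← (Equiv.subLeft (-1 : ℤ)).hasSum_iff] at h
  rw [S_eq, mul_div_cancel_left₀ _ (by positivity)]
  convert h using 2 with w
  simp only [Function.comp, Equiv.subLeft_apply, ff]
  rw [← EE_neg]
  push_cast
  congr 1
  · congr 1; ring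
  · ring

lemma S_refl4 (c : ℝ) (hc : 0 < c) (η : ℝ) :
    HasSum (fun w : ℤ => ff c η w / (1 - 4 * (w : ℝ))) (S c (2 - η) / (4 / Real.pi)) := by
  have h := (summable_ffd c hc (2 - η)).hasSum
  rw [← (Equiv.neg ℤ).hasSum_iff] at h
  rw [S_eq, mul_div_cancel_left₀ _ (by positivity)]
  convert h using 2 with w
  simp only [Function.comp, Equiv.neg_apply, ff]
  rw [← EE_neg]
  push_cast
  congr 1
  · congr 1; ring
  · ring

lemma S_has (c : ℝ) (hc : 0 < c) (η : ℝ) :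
    HasSum (fun w : ℤ => ff c η w / (4 * (w : ℝ) + 1)) (S c η / (4 / Real.pi)) := by
  rw [S_eq, mul_div_cancel_left₀ _ (by positivity)]
  exact (summable_ffd c hc η).hasSum

lemma L_has (c : ℝ) (hc : 0 < c) (η : ℝ) :
    HasSum (ff c η) (L c η / (2 / Real.pi)) := by
  rw [L_eq, mul_div_cancel_left₀ _ (by positivity)]
  exact (summable_ff c hc η).hasSum

theorem L_S_inequality (c : ℝ) (hc : 0 < c) (η₁ η₄ : ℝ)
    (h1 : η₁ ∈ Set.Icc (-3 : ℝ) (-1)) (h4 : η₄ ∈ Set.Icc (1 : ℝ) 3)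
    (hdiff : η₄ - η₁ ≤ 4) :
    L c η₁ - (3 / 4) * (S c η₁ + S c (-2 - η₁)) ≤
      L c η₄ + (3 / 4) * S c (2 - η₄) - (5 / 4) * S c η₄ := by
  obtain ⟨h1a, h1b⟩ := h1
  obtain ⟨h4a, h4b⟩ := h4
  have A := (L_has c hc η₁).sub
    (((S_has c hc η₁).add (S_refl1 c hc η₁)).mul_left (3 / 2))
  have B := ((L_has c hc η₄).add ((S_refl4 c hc η₄).mul_left (3 / 2))).sub
    ((S_has c hc η₄).mul_left (5 / 2))
  have A' := A.nat_add_neg_add_one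
  have B' := B.nat_add_neg
  have key := hasSum_le (fun q : ℕ => ?_) A' B'
  · have hB0 : ff c η₄ 0 + 3 / 2 * (ff c η₄ 0 / (1 - 4 * ((0 : ℤ) : ℝ)))
        - 5 / 2 * (ff c η₄ 0 / (4 * ((0 : ℤ) : ℝ) + 1)) = 0 := by
      push_cast; ring
    rw [hB0] at key
    have hp := Real.pi_pos
    have e1 : ∀ x : ℝ, x / (2 / Real.pi) = Real.pi / 2 * x := fun x => by field_simp
    have e2 : ∀ x : ℝ, x / (4 / Real.pi) = Real.pi / 4 * x := fun x => by field_simp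
    simp only [e1, e2] at key
    have : 0 < Real.pi / 2 := by positivity
    refine le_of_mul_le_mul_left ?_ this
    linarith
  · rcases Nat.eq_zero_or_pos q with rfl | hq
    · push_cast; norm_num; apply le_of_eq; ring
    · have hq1 : (1 : ℝ) ≤ q := by exact_mod_cast hq
      -- the four sample values
      have u1 : ff c η₁ q ≤ EE c (4 * q + (η₄ - 1)) := by
        rw [ff, ← EE_neg]; apply EE_anti <;> push_cast <;> linarith
      have u2 : ff c η₁ (-(q + 1)) ≤ EE c (4 * q + (η₄ - 1)) := by
        rw [ff]; apply EE_anti <;> push_cast <;> linarith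
      have v1 : EE c (4 * q + (η₄ - 1)) ≤ ff c η₄ q := by
        rw [ff, ← EE_neg c (η₄ - _ - _)]; apply EE_anti <;> push_cast <;> linarith
      have v2 : ff c η₄ (-q) = EE c (4 * q + (η₄ - 1)) := by
        rw [ff]; congr 1; push_cast; ring
      have n0 := EE_nonneg c (4 * q + (η₄ - 1))
      have p1 : (0 : ℝ) < 4 * q + 1 := by linarith
      have p3 : (0 : ℝ) < 4 * q + 3 := by linarith
      have pm : (0 : ℝ) < 4 * q - 1 := by linarith
      rw [v2]
      set X := EE c (4 * q + (η₄ - 1))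
      have k0 : 0 ≤ 1 - 3 / ((4 * (q : ℝ) + 1) * (4 * q + 3)) := by
        rw [sub_nonneg, div_le_one (by positivity)]; nlinarith
      have k1 : 1 - 3 / ((4 * (q : ℝ) + 1) * (4 * q + 3)) ≤ 1 := by
        have : 0 ≤ 3 / ((4 * (q : ℝ) + 1) * (4 * q + 3)) := by positivity
        linarith
      have b0 : 0 ≤ 16 * (q : ℝ) * (q - 1) / ((4 * q + 1) * (4 * q - 1)) := by
        have : (0 : ℝ) ≤ q - 1 := by linarith
        positivity
      have m1 : (1 - 4 * (q : ℝ)) ≠ 0 := by linarith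
      have m2 : (-4 * (q : ℝ) + 1) ≠ 0 := by linarith
      have m3 : (-4 * (q : ℝ) - 3) ≠ 0 := by linarith
      have cB : 1 + 3 / 2 * (1 / (1 - 4 * (q : ℝ))) - 5 / 2 * (1 / (4 * q + 1))
          = 16 * (q : ℝ) * (q - 1) / ((4 * q + 1) * (4 * q - 1)) := by
        field_simp; ring
      have cS : 16 * (q : ℝ) * (q - 1) / ((4 * q + 1) * (4 * q - 1)) +
          (1 + 3 / 2 * (1 / (1 + 4 * (q : ℝ))) - 5 / 2 * (1 / (-4 * q + 1)))
          = 2 + 2 / ((4 * q + 1) * (4 * q - 1)) := by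
        rw [show -4 * (q : ℝ) + 1 = -(4 * q - 1) by ring, show 1 + 4 * (q : ℝ) = 4 * q + 1 by ring,
          div_neg]
        obtain ⟨y, hy⟩ : ∃ y : ℝ, y = 4 * q - 1 := ⟨_, rfl⟩
        have hqy : (q : ℝ) = (y + 1) / 4 := by linarith
        have hy0 : y ≠ 0 := by rw [hy]; exact pm.ne'
        have hy2 : y + 2 ≠ 0 := by rw [hy]; intro h; linarith
        rw [← hy, show 4 * (q : ℝ) + 1 = y + 2 by linarith, hqy]
        field_simp; ring
      have hpos : 0 ≤ 2 / ((4 * (q : ℝ) + 1) * (4 * q - 1)) := by positivity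
      have cA : 1 - 3 / 2 * (1 / (4 * (q : ℝ) + 1) + 1 / (-4 * q - 3))
          = 1 - 3 / ((4 * (q : ℝ) + 1) * (4 * q + 3)) := by
        rw [show -4 * (q : ℝ) - 3 = -(4 * q + 3) by ring, div_neg]
        field_simp; ring
      calc _ = (1 - 3 / ((4 * (q : ℝ) + 1) * (4 * q + 3))) * (ff c η₁ q + ff c η₁ (-(q + 1))) := by
            rw [← cA]; push_cast
            have : (4 * (-1 + -(q : ℝ)) + 1) = -4 * q - 3 := by ring
            have : (4 * -((q : ℝ) + 1) + 1) = -4 * q - 3 := by ring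
            rw [this]
            have : (-4 * -((q : ℝ) + 1) - 3) = 4 * q + 1 := by ring
            rw [this]
            ring
        _ ≤ 1 * (X + X) := by
            apply mul_le_mul k1 (add_le_add u1 u2) (add_nonneg (EE_nonneg _ _) (EE_nonneg _ _))
            norm_num
        _ ≤ (2 + 2 / ((4 * q + 1) * (4 * q - 1))) * X := by nlinarith
        _ ≤ 16 * (q : ℝ) * (q - 1) / ((4 * q + 1) * (4 * q - 1)) * ff c η₄ q +
            (1 + 3 / 2 * (1 / (1 + 4 * (q : ℝ))) - 5 / 2 * (1 / (-4 * q + 1))) * X := by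
            rw [← cS]
            have := mul_le_mul_of_nonneg_left v1 b0
            linarith
        _ = _ := by
            rw [← cB]; push_cast
            have : (1 - 4 * -(q : ℝ)) = 1 + 4 * q := by ring
            rw [this]
            have : (4 * -(q : ℝ) + 1) = -4 * q + 1 := by ring
            rw [this]
            ring

end
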